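/- With the setup of one permutation hashing (f = f₁+f₂-a ≥ 2, R = a/f), the unbiased estimator R̂ = N_mat/(k-N_emp) has variance Var(R̂) = R(1-R)·( E[1/(k-N_emp)]·(1 + 1/(f-1)) - 1/(f-1) ). -/

import Mathlib

open scoped BigOperators Classical

/-- Restriction of the hashed set `S` to the `j`-th of `k` equal consecutive bins of
`{0,...,D-1}` (each bin has length `D/k`). -/
def hashBin (D k : ℕ) (S : Finset (Fin D)) (j : ℕ) : Finset (Fin D) :=
  S.filter (fun x => x.val / (D / k) = j)

/-- The `j`-th bin is matched: both `π(S₁)` and `π(S₂)` are nonempty in the bin and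
their smallest elements in the bin coincide. -/
def matchedBin (D k : ℕ) (π : Equiv.Perm (Fin D)) (S₁ S₂ : Finset (Fin D)) (j : ℕ) : Prop :=
  (hashBin D k (S₁.image π) j).Nonempty ∧ (hashBin D k (S₂.image π) j).Nonempty ∧
    (hashBin D k (S₁.image π) j).min = (hashBin D k (S₂.image π) j).min

/-- The number of matched bins. -/
noncomputable def Nmat (D k : ℕ) (π : Equiv.Perm (Fin D)) (S₁ S₂ : Finset (Fin D)) : ℕ :=
  ((Finset.range k).filter (fun j => matchedBin D k π S₁ S₂ j)).card

/-- The number of jointly empty bins: bins where both `π(S₁)` and `π(S₂)` are empty. -/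
noncomputable def NempJ (D k : ℕ) (π : Equiv.Perm (Fin D)) (S₁ S₂ : Finset (Fin D)) : ℕ :=
  ((Finset.range k).filter (fun j =>
    hashBin D k (S₁.image π) j = ∅ ∧ hashBin D k (S₂.image π) j = ∅)).card

/-- The elements of `U` whose image under `π` is the smallest element of `π(U)` in its bin,
the bins being the fibres of `b`. -/
noncomputable def binMinimizers {α : Type*} [LinearOrder α] (b : α → ℕ) (U : Finset α)
    (π : Equiv.Perm α) : Finset α :=
  U.filter (fun x => ∀ y ∈ U, b (π y) = b (π x) → π x ≤ π y)

section BinMinimizers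

variable {α : Type*} [LinearOrder α] {b : α → ℕ} {U : Finset α} {π : Equiv.Perm α}

lemma mem_binMinimizers {x : α} :
    x ∈ binMinimizers b U π ↔ x ∈ U ∧ ∀ y ∈ U, b (π y) = b (π x) → π x ≤ π y := by
  simp [binMinimizers]

lemma binMinimizers_subset : binMinimizers b U π ⊆ U :=
  Finset.filter_subset _ _

lemma injOn_binMinimizers : Set.InjOn (fun x => b (π x)) (binMinimizers b U π) := by
  intro x hx y hy hxy
  have hx' := mem_binMinimizers.1 hx
  have hy' := mem_binMinimizers.1 hy
  exact π.injective (le_antisymm (hx'.2 y hy'.1 hxy.symm) (hy'.2 x hx'.1 hxy))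

lemma exists_mem_binMinimizers {x : α} (hx : x ∈ U) :
    ∃ z ∈ binMinimizers b U π, b (π z) = b (π x) := by
  obtain ⟨z, hz, hmin⟩ := Finset.exists_min_image (U.filter (fun y => b (π y) = b (π x))) π
    ⟨x, by simp [hx]⟩
  rw [Finset.mem_filter] at hz
  refine ⟨z, mem_binMinimizers.2 ⟨hz.1, fun y hy hyz => hmin y ?_⟩, hz.2⟩
  exact Finset.mem_filter.2 ⟨hy, hyz.trans hz.2⟩

lemma mem_binMinimizers_mul {σ : Equiv.Perm α} (hσ : ∀ x, σ x ∈ U ↔ x ∈ U) {x : α} :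
    x ∈ binMinimizers b U (π * σ) ↔ σ x ∈ binMinimizers b U π := by
  rw [mem_binMinimizers, mem_binMinimizers, hσ]
  refine and_congr_right fun _ => ⟨fun h y hy hyx => ?_, fun h y hy hyx => ?_⟩
  · simpa using h (σ⁻¹ y) (by rw [← hσ]; simpa using hy) (by simpa using hyx)
  · exact h (σ y) ((hσ y).2 hy) hyx

lemma card_binMinimizers_mul {σ : Equiv.Perm α} (hσ : ∀ x, σ x ∈ U ↔ x ∈ U) :
    (binMinimizers b U (π * σ)).card = (binMinimizers b U π).card := by
  refine Finset.card_bij (fun x _ => σ x) (fun x hx => (mem_binMinimizers_mul hσ).1 hx)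
    (fun x _ y _ h => σ.injective h) (fun y hy => ⟨σ⁻¹ y, ?_, by simp⟩)
  rw [mem_binMinimizers_mul hσ]
  simpa using hy

end BinMinimizers

lemma swap_mem_iff {α : Type*} [DecidableEq α] {U : Finset α} {x y : α} (hx : x ∈ U) (hy : y ∈ U)
    (z : α) : Equiv.swap x y z ∈ U ↔ z ∈ U := by
  rw [Equiv.swap_apply_def]
  split_ifs with h h' <;> simp_all

lemma exists_perm_pair {α : Type*} [DecidableEq α] {U : Finset α} {x y x' y' : α} (hx : x ∈ U)
    (hy : y ∈ U) (hx' : x' ∈ U) (hy' : y' ∈ U) (h : x ≠ y) (h' : x' ≠ y') :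
    ∃ σ : Equiv.Perm α, (∀ z, σ z ∈ U ↔ z ∈ U) ∧ σ x = x' ∧ σ y = y' := by
  have hmem : Equiv.swap x x' y ∈ U := (swap_mem_iff hx hx' y).2 hy
  refine ⟨Equiv.swap (Equiv.swap x x' y) y' * Equiv.swap x x', fun z => ?_, ?_, ?_⟩
  · rw [Equiv.Perm.mul_apply, swap_mem_iff hmem hy', swap_mem_iff hx hx']
  · rw [Equiv.Perm.mul_apply, Equiv.swap_apply_left]
    refine Equiv.swap_apply_of_ne_of_ne (fun hxy => h ?_) h'
    apply (Equiv.swap x x').injective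
    rw [Equiv.swap_apply_left, ← hxy]
  · rw [Equiv.Perm.mul_apply, Equiv.swap_apply_left]

/-- If `c` is invariant under the permutations preserving `U`, its sum over `A × A` is determined
by its diagonal and total sums over `U`. -/
lemma sum_sum_of_invariant {α : Type*} [DecidableEq α] {U A : Finset α} (hA : A ⊆ U)
    (hU : 2 ≤ U.card) (c : α → α → ℝ)
    (hc : ∀ σ : Equiv.Perm α, (∀ z, σ z ∈ U ↔ z ∈ U) → ∀ x y, c (σ x) (σ y) = c x y) :
    ∑ x ∈ A, ∑ y ∈ A, c x y = A.card / U.card * ∑ x ∈ U, c x x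
      + A.card * (A.card - 1) / (U.card * (U.card - 1)) *
        (∑ x ∈ U, ∑ y ∈ U, c x y - ∑ x ∈ U, c x x) := by
  obtain ⟨p, hp, q, hq, hpq⟩ := Finset.one_lt_card.1 (show 1 < U.card by omega)
  have hdiag : ∀ x ∈ U, c x x = c p p := fun x hx => by
    simpa using hc (Equiv.swap p x) (swap_mem_iff hp hx) p p
  have hoff : ∀ x ∈ U, ∀ y ∈ U, x ≠ y → c x y = c p q := fun x hx y hy hxy => by
    obtain ⟨σ, hσ, rfl, rfl⟩ := exists_perm_pair hp hq hx hy hpq hxy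
    exact hc σ hσ p q
  have key : ∀ B ⊆ U, ∑ x ∈ B, ∑ y ∈ B, c x y
      = B.card * c p p + B.card * (B.card - 1) * c p q := fun B hB => by
    have hrow : ∀ x ∈ B, ∑ y ∈ B, c x y = c p p + (B.card - 1) * c p q := fun x hx => by
      rw [← Finset.add_sum_erase _ _ hx, hdiag x (hB hx), Finset.sum_congr rfl
        (fun y hy => hoff x (hB hx) y (hB (Finset.mem_of_mem_erase hy))
          (Finset.ne_of_mem_erase hy).symm), Finset.sum_const, nsmul_eq_mul,
        Finset.cast_card_erase_of_mem hx]
    rw [Finset.sum_congr rfl hrow, Finset.sum_const, nsmul_eq_mul]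
    ring
  have hU2 : (2 : ℝ) ≤ U.card := by exact_mod_cast hU
  have h0 : (U.card : ℝ) ≠ 0 := by linarith
  have h1 : (U.card : ℝ) - 1 ≠ 0 := by linarith
  rw [key A hA, key U subset_rfl, Finset.sum_congr rfl hdiag, Finset.sum_const, nsmul_eq_mul]
  field_simp
  ring

lemma card_inter_eq_sum {α : Type*} [DecidableEq α] (A M : Finset α) :
    ((A ∩ M).card : ℝ) = ∑ x ∈ A, if x ∈ M then 1 else 0 := by
  rw [Finset.sum_boole, Finset.filter_mem_eq_inter]

/-- Second moment of the proportion of bin minimizers lying in `A ⊆ U`. -/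
lemma sum_sq_card_inter_binMinimizers {α : Type*} [LinearOrder α] [Fintype α] (b : α → ℕ)
    {U A : Finset α} (hA : A ⊆ U) (hU : 2 ≤ U.card) :
    ∑ π : Equiv.Perm α,
        (((A ∩ binMinimizers b U π).card : ℝ) / (binMinimizers b U π).card) ^ 2
      = A.card / U.card * ∑ π : Equiv.Perm α, 1 / ((binMinimizers b U π).card : ℝ)
        + A.card * (A.card - 1) / (U.card * (U.card - 1)) *
          (Fintype.card (Equiv.Perm α) -
            ∑ π : Equiv.Perm α, 1 / ((binMinimizers b U π).card : ℝ)) := by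
  set w : Equiv.Perm α → ℝ := fun π => (((binMinimizers b U π).card : ℝ) ^ 2)⁻¹ with hw
  set c : α → α → ℝ := fun x y => ∑ π : Equiv.Perm α, w π *
    ((if x ∈ binMinimizers b U π then 1 else 0) * (if y ∈ binMinimizers b U π then 1 else 0))
    with hc
  have hinv : ∀ σ : Equiv.Perm α, (∀ z, σ z ∈ U ↔ z ∈ U) → ∀ x y, c (σ x) (σ y) = c x y := by
    intro σ hσ x y
    rw [hc]
    refine Eq.trans ?_ (Equiv.sum_comp (Equiv.mulRight σ) _)
    refine Finset.sum_congr rfl fun π _ => ?_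
    simp only [hw, Equiv.coe_mulRight, mem_binMinimizers_mul hσ, card_binMinimizers_mul hσ]
  have hpos : ∀ π : Equiv.Perm α, ((binMinimizers b U π).card : ℝ) ≠ 0 := fun π => by
    obtain ⟨x, hx⟩ := Finset.card_pos.1 (show 0 < U.card by omega)
    obtain ⟨z, hz, -⟩ := exists_mem_binMinimizers (b := b) (π := π) hx
    exact_mod_cast (Finset.card_pos.2 ⟨z, hz⟩).ne'
  have htotal : ∀ B : Finset α, ∑ x ∈ B, ∑ y ∈ B, c x y = ∑ π : Equiv.Perm α,
      (((B ∩ binMinimizers b U π).card : ℝ) / (binMinimizers b U π).card) ^ 2 := fun B => by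
    simp only [hc]
    rw [Finset.sum_congr rfl fun x _ => Finset.sum_comm, Finset.sum_comm]
    refine Finset.sum_congr rfl fun π _ => ?_
    simp only [← Finset.mul_sum, ← Finset.sum_mul, ← card_inter_eq_sum]
    rw [hw, div_pow, div_eq_inv_mul, sq ((B ∩ _).card : ℝ)]
  have hinter : ∀ π : Equiv.Perm α, U ∩ binMinimizers b U π = binMinimizers b U π := fun π =>
    Finset.inter_eq_right.2 binMinimizers_subset
  have hdiag : ∑ x ∈ U, c x x
      = ∑ π : Equiv.Perm α, 1 / ((binMinimizers b U π).card : ℝ) := by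
    simp only [hc]
    rw [Finset.sum_comm]
    refine Finset.sum_congr rfl fun π _ => ?_
    have hsq : ∀ x, (if x ∈ binMinimizers b U π then (1 : ℝ) else 0) *
        (if x ∈ binMinimizers b U π then 1 else 0) = if x ∈ binMinimizers b U π then 1 else 0 :=
      fun x => by split_ifs <;> simp
    simp only [hsq, ← Finset.mul_sum, ← card_inter_eq_sum, hinter, hw]
    have := hpos π
    field_simp
  rw [← htotal, sum_sum_of_invariant hA hU c hinv, hdiag, htotal U]
  have hone : ∀ π : Equiv.Perm α, (((U ∩ binMinimizers b U π).card : ℝ) /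
      (binMinimizers b U π).card) ^ 2 = 1 := fun π => by
    rw [hinter, div_self (hpos π), one_pow]
  simp only [hone, Finset.sum_const, Finset.card_univ, nsmul_eq_mul, mul_one]

section Hashing

variable {D k : ℕ} {π : Equiv.Perm (Fin D)} {S₁ S₂ : Finset (Fin D)}

lemma mem_hashBin_image {S : Finset (Fin D)} {j : ℕ} {z : Fin D} :
    z ∈ hashBin D k (S.image π) j ↔ ∃ x ∈ S, π x = z ∧ (π x).val / (D / k) = j := by
  simp only [hashBin, Finset.mem_filter, Finset.mem_image]
  constructor
  · rintro ⟨⟨x, hx, rfl⟩, hj⟩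
    exact ⟨x, hx, rfl, hj⟩
  · rintro ⟨x, hx, rfl, hj⟩
    exact ⟨⟨x, hx, rfl⟩, hj⟩

lemma bin_lt (hk : 1 ≤ k) (hkD : k ∣ D) (z : Fin D) : z.val / (D / k) < k := by
  obtain ⟨q, rfl⟩ := hkD
  rw [Nat.mul_div_cancel_left q hk]
  exact Nat.div_lt_of_lt_mul (z.isLt.trans_eq (mul_comm k q))

lemma sub_NempJ_eq_card (hk : 1 ≤ k) (hkD : k ∣ D) :
    (k : ℝ) - NempJ D k π S₁ S₂
      = (binMinimizers (fun z : Fin D => z.val / (D / k)) (S₁ ∪ S₂) π).card := by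
  have hcard : (binMinimizers (fun z : Fin D => z.val / (D / k)) (S₁ ∪ S₂) π).card
      = ((Finset.range k).filter (fun j => ¬ (hashBin D k (S₁.image π) j = ∅ ∧
          hashBin D k (S₂.image π) j = ∅))).card := by
    rw [← Finset.card_image_of_injOn injOn_binMinimizers]
    congr 1
    ext j
    have hne : ¬ (hashBin D k (S₁.image π) j = ∅ ∧ hashBin D k (S₂.image π) j = ∅) ↔
        ∃ x ∈ S₁ ∪ S₂, (π x).val / (D / k) = j := by
      rw [not_and_or, ← ne_eq, ← ne_eq, ← Finset.nonempty_iff_ne_empty,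
        ← Finset.nonempty_iff_ne_empty]
      simp only [Finset.Nonempty, mem_hashBin_image, Finset.mem_union]
      grind
    rw [Finset.mem_image, Finset.mem_filter, Finset.mem_range, hne]
    constructor
    · rintro ⟨x, hx, rfl⟩
      exact ⟨bin_lt hk hkD _, x, binMinimizers_subset hx, rfl⟩
    · rintro ⟨-, x, hx, rfl⟩
      exact exists_mem_binMinimizers hx
  have hsum := Finset.card_filter_add_card_filter_not (s := Finset.range k)
    (fun j => hashBin D k (S₁.image π) j = ∅ ∧ hashBin D k (S₂.image π) j = ∅)
  rw [← hcard, Finset.card_range] at hsum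
  rw [NempJ, sub_eq_iff_eq_add']
  exact_mod_cast hsum.symm

lemma matchedBin_iff {j : ℕ} : matchedBin D k π S₁ S₂ j ↔
    ∃ x ∈ (S₁ ∩ S₂) ∩ binMinimizers (fun z : Fin D => z.val / (D / k)) (S₁ ∪ S₂) π,
      (π x).val / (D / k) = j := by
  constructor
  · rintro ⟨hn₁, hn₂, hmin⟩
    obtain ⟨z, hz⟩ := Finset.min_of_nonempty hn₁
    obtain ⟨x, hx₁, rfl, hxj⟩ := mem_hashBin_image.1 (Finset.mem_of_min hz)
    obtain ⟨x', hx₂, hxx', -⟩ := mem_hashBin_image.1 (Finset.mem_of_min (hmin ▸ hz))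
    obtain rfl := π.injective hxx'
    refine ⟨x', ?_, hxj⟩
    rw [Finset.mem_inter, Finset.mem_inter, mem_binMinimizers]
    refine ⟨⟨hx₁, hx₂⟩, Finset.mem_union_left _ hx₁, fun y hy hyx => ?_⟩
    rcases Finset.mem_union.1 hy with hy | hy
    · exact Finset.min_le_of_eq (mem_hashBin_image.2 ⟨y, hy, rfl, hyx.trans hxj⟩) hz
    · exact Finset.min_le_of_eq (mem_hashBin_image.2 ⟨y, hy, rfl, hyx.trans hxj⟩) (hmin ▸ hz)
  · rintro ⟨x, hx, hxj⟩
    rw [Finset.mem_inter, Finset.mem_inter, mem_binMinimizers] at hx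
    obtain ⟨⟨hx₁, hx₂⟩, -, hmin⟩ := hx
    have key : ∀ S ⊆ S₁ ∪ S₂, x ∈ S → π x ∈ hashBin D k (S.image π) j ∧
        (hashBin D k (S.image π) j).min = (π x : WithTop (Fin D)) := fun S hS hxS => by
      have hmem : π x ∈ hashBin D k (S.image π) j := mem_hashBin_image.2 ⟨x, hxS, rfl, hxj⟩
      refine ⟨hmem, le_antisymm (Finset.min_le hmem) (Finset.le_min fun z hz => ?_)⟩
      obtain ⟨y, hy, rfl, hyj⟩ := mem_hashBin_image.1 hz
      exact WithTop.coe_le_coe.2 (hmin y (hS hy) (hyj.trans hxj.symm))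
    obtain ⟨hm₁, he₁⟩ := key S₁ Finset.subset_union_left hx₁
    obtain ⟨hm₂, he₂⟩ := key S₂ Finset.subset_union_right hx₂
    exact ⟨⟨_, hm₁⟩, ⟨_, hm₂⟩, he₁.trans he₂.symm⟩

lemma Nmat_eq_card (hk : 1 ≤ k) (hkD : k ∣ D) :
    Nmat D k π S₁ S₂ = ((S₁ ∩ S₂) ∩
      binMinimizers (fun z : Fin D => z.val / (D / k)) (S₁ ∪ S₂) π).card := by
  rw [Nmat, ← Finset.card_image_of_injOn (injOn_binMinimizers.mono
    (Finset.coe_subset.2 Finset.inter_subset_right))]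
  congr 1
  ext j
  rw [Finset.mem_filter, Finset.mem_range, matchedBin_iff, Finset.mem_image]
  refine ⟨And.right, fun h => ⟨?_, h⟩⟩
  obtain ⟨x, -, rfl⟩ := h
  exact bin_lt hk hkD _

end Hashing

/-- Variance of the unbiased estimator `R̂ = N_mat/(k-N_emp)`:
`Var(R̂) = R(1-R)·(E[1/(k-N_emp)]·(1+1/(f-1)) - 1/(f-1))`. -/
theorem stmt_12 (D k f₁ f₂ a f : ℕ) (R : ℝ) (hk : 1 ≤ k) (hkD : k ∣ D)
    (S₁ S₂ : Finset (Fin D)) (h₁ : S₁.card = f₁) (h₂ : S₂.card = f₂)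
    (ha : (S₁ ∩ S₂).card = a) (hf : (S₁ ∪ S₂).card = f) (hfeq : f = f₁ + f₂ - a)
    (hf2 : 2 ≤ f) (hR : R = (a : ℝ) / f) :
    let N : ℝ := (Fintype.card (Equiv.Perm (Fin D)) : ℝ)
    (∑ π : Equiv.Perm (Fin D),
        ((Nmat D k π S₁ S₂ : ℝ) / ((k : ℝ) - NempJ D k π S₁ S₂)) ^ 2) / N - R ^ 2
      = R * (1 - R) *
          ((∑ π : Equiv.Perm (Fin D), 1 / ((k : ℝ) - NempJ D k π S₁ S₂)) / N
              * (1 + 1 / ((f : ℝ) - 1))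
            - 1 / ((f : ℝ) - 1)) := by
  intro N
  have hN : N ≠ 0 := Nat.cast_ne_zero.2 Fintype.card_ne_zero
  have hf2' : (2 : ℝ) ≤ f := by exact_mod_cast hf2
  have h0 : (f : ℝ) ≠ 0 := by linarith
  have h1 : (f : ℝ) - 1 ≠ 0 := by linarith
  have hsub : S₁ ∩ S₂ ⊆ S₁ ∪ S₂ :=
    Finset.inter_subset_left.trans Finset.subset_union_left
  simp only [Nmat_eq_card hk hkD, sub_NempJ_eq_card hk hkD]
  rw [sum_sq_card_inter_binMinimizers _ hsub (by omega), ha, hf, hR]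
  change ((a : ℝ) / f * _ + a * (a - 1) / (f * (f - 1)) * (N - _)) / N - _ = _
  generalize (∑ π : Equiv.Perm (Fin D), 1 / ((binMinimizers _ (S₁ ∪ S₂) π).card : ℝ)) = T
  field_simp
  ring
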